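/- For every real λ ≥ 2, 2·∫_λ^∞ x²·((1/2)(1 + √(1 − 4/x²)))²·φ(x) dx = (λ + √(λ² − 4))·φ(λ) + e^{−2}·Q(√(λ² − 4)) − Q(λ). (Closed-form residual-variance constant ρ(λ) of GSW filtering in the real-valued case.) -/

import Mathlib

/-- Standard normal density. -/
noncomputable def stdNormalPdf (x : ℝ) : ℝ := Real.exp (-x ^ 2 / 2) / Real.sqrt (2 * Real.pi)

/-- Gaussian tail function `Q`. -/
noncomputable def gaussQ (x : ℝ) : ℝ := ∫ t in Set.Ioi x, stdNormalPdf t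

open MeasureTheory Filter Topology Set in
theorem stdNormalPdf_integrable : Integrable stdNormalPdf := by
  have h := (integrable_exp_neg_mul_sq (b := 1 / 2) (by norm_num)).div_const (Real.sqrt (2 * Real.pi))
  refine h.congr (Eventually.of_forall fun x => ?_)
  simp only [stdNormalPdf]
  congr 2
  ring

theorem stdNormalPdf_continuous : Continuous stdNormalPdf := by
  unfold stdNormalPdf
  fun_prop

theorem stdNormalPdf_nonneg (x : ℝ) : 0 ≤ stdNormalPdf x := by
  unfold stdNormalPdf
  positivity

open MeasureTheory Filter Topology Set in
theorem gaussQ_eq (x : ℝ) : gaussQ x = gaussQ 0 - ∫ t in (0 : ℝ)..x, stdNormalPdf t := by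
  have := intervalIntegral.integral_interval_add_Ioi (a := (0 : ℝ)) (b := x) (f := stdNormalPdf)
    (μ := volume) stdNormalPdf_integrable.integrableOn stdNormalPdf_integrable.integrableOn
  unfold gaussQ
  linarith

theorem gaussQ_hasDerivAt (x : ℝ) : HasDerivAt gaussQ (-stdNormalPdf x) x := by
  have h : HasDerivAt (fun u => ∫ t in (0 : ℝ)..u, stdNormalPdf t) (stdNormalPdf x) x :=
    stdNormalPdf_continuous.integral_hasStrictDerivAt 0 x |>.hasDerivAt
  have h2 := h.const_sub (gaussQ 0)
  have : gaussQ = fun u => gaussQ 0 - ∫ t in (0 : ℝ)..u, stdNormalPdf t := funext gaussQ_eq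
  rw [this]
  exact h2

open MeasureTheory Filter Topology Set in
theorem gaussQ_tendsto : Tendsto gaussQ atTop (𝓝 0) := by
  have h := intervalIntegral_tendsto_integral_Ioi (0 : ℝ)
    (stdNormalPdf_integrable.integrableOn (s := Ioi 0)) tendsto_id
  have h2 := h.const_sub (gaussQ 0)
  have : gaussQ = fun u => gaussQ 0 - ∫ t in (0 : ℝ)..u, stdNormalPdf t := funext gaussQ_eq
  rw [show (∫ t in Ioi (0 : ℝ), stdNormalPdf t) = gaussQ 0 from rfl, sub_self] at h2
  rw [this]
  exact h2

theorem stdNormalPdf_hasDerivAt (x : ℝ) : HasDerivAt stdNormalPdf (-x * stdNormalPdf x) x := by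
  have h : HasDerivAt (fun y : ℝ => -y ^ 2 / 2) (-x) x := by
    have := ((hasDerivAt_pow 2 x).neg).div_const 2
    exact this.congr_deriv (by norm_num; ring)
  have h2 := (h.exp).div_const (Real.sqrt (2 * Real.pi))
  refine HasDerivAt.congr_deriv h2 ?_
  simp only [stdNormalPdf]
  ring

open MeasureTheory Filter Topology Set in
theorem sqrt_tendsto_aux : Tendsto (fun x : ℝ => Real.sqrt (x ^ 2 - 4)) atTop atTop := by
  apply Real.tendsto_sqrt_atTop.comp
  exact tendsto_atTop_add_const_right _ _ (tendsto_pow_atTop (by norm_num))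

open MeasureTheory Filter Topology Set in
theorem boundary_tendsto : Tendsto (fun x : ℝ => (x + Real.sqrt (x ^ 2 - 4)) * stdNormalPdf x)
    atTop (𝓝 0) := by
  have h := ((Real.tendsto_pow_mul_exp_neg_atTop_nhds_zero 1).const_mul 2).div_const
    (Real.sqrt (2 * Real.pi))
  rw [mul_zero, zero_div] at h
  refine tendsto_of_tendsto_of_tendsto_of_le_of_le' tendsto_const_nhds h ?_ ?_
  · filter_upwards [eventually_ge_atTop 2] with x hx
    have := stdNormalPdf_nonneg x
    positivity
  · filter_upwards [eventually_ge_atTop 2] with x hx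
    have h1 : Real.sqrt (x ^ 2 - 4) ≤ x := Real.sqrt_le_iff.2 ⟨by linarith, by linarith⟩
    have h2 : Real.exp (-x ^ 2 / 2) ≤ Real.exp (-x) := Real.exp_le_exp.2 (by nlinarith)
    unfold stdNormalPdf
    rw [← mul_div_assoc, pow_one, ← mul_assoc]
    gcongr
    linarith

theorem pdf_sqrt_aux (x : ℝ) (hx : 2 ≤ x) :
    Real.exp (-2) * stdNormalPdf (Real.sqrt (x ^ 2 - 4)) = stdNormalPdf x := by
  unfold stdNormalPdf
  rw [Real.sq_sqrt (by nlinarith), ← mul_div_assoc, ← Real.exp_add]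
  congr 2
  ring

/-- Closed-form residual-variance constant `ρ(λ)` of GSW filtering in the
real-valued case. -/
theorem rhoGSW_real_closed_form (lam : ℝ) (hlam : 2 ≤ lam) :
    2 * ∫ x in Set.Ioi lam,
        x ^ 2 * ((1 / 2) * (1 + Real.sqrt (1 - 4 / x ^ 2))) ^ 2 * stdNormalPdf x =
      (lam + Real.sqrt (lam ^ 2 - 4)) * stdNormalPdf lam +
        Real.exp (-2) * gaussQ (Real.sqrt (lam ^ 2 - 4)) - gaussQ lam := by
  have hQc : Continuous gaussQ :=
    continuous_iff_continuousAt.2 fun x => (gaussQ_hasDerivAt x).continuousAt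
  have hpc := stdNormalPdf_continuous
  have key := MeasureTheory.integral_Ioi_of_hasDerivAt_of_nonneg (a := lam) (l := 0)
    (g := fun x => gaussQ x - (x + Real.sqrt (x ^ 2 - 4)) * stdNormalPdf x -
      Real.exp (-2) * gaussQ (Real.sqrt (x ^ 2 - 4)))
    (g' := fun x => 2 * (x ^ 2 * ((1 / 2) * (1 + Real.sqrt (1 - 4 / x ^ 2))) ^ 2 * stdNormalPdf x))
    (Continuous.continuousWithinAt (by fun_prop)) ?_ ?_ ?_
  · rw [MeasureTheory.integral_const_mul] at key
    rw [key]
    ring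
  · intro x hx
    have hx2 : 2 < x := lt_of_le_of_lt hlam hx
    have hpos : 0 < x ^ 2 - 4 := by nlinarith
    have hs : HasDerivAt (fun y : ℝ => Real.sqrt (y ^ 2 - 4)) (x / Real.sqrt (x ^ 2 - 4)) x := by
      have h1 := ((hasDerivAt_pow 2 x).sub_const 4).sqrt hpos.ne'
      refine h1.congr_deriv ?_
      norm_num
      rw [mul_div_mul_left _ _ two_ne_zero]
    have hq := ((gaussQ_hasDerivAt (Real.sqrt (x ^ 2 - 4))).comp x hs).const_mul (Real.exp (-2))
    have hb := ((hasDerivAt_id x).add hs).mul (stdNormalPdf_hasDerivAt x)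
    have hall := ((gaussQ_hasDerivAt x).sub hb).sub hq
    refine HasDerivAt.congr_deriv hall ?_
    have hp := pdf_sqrt_aux x hx2.le
    have hu : 0 < Real.sqrt (x ^ 2 - 4) := Real.sqrt_pos.2 hpos
    have husq : Real.sqrt (x ^ 2 - 4) ^ 2 = x ^ 2 - 4 := Real.sq_sqrt hpos.le
    have hsx : Real.sqrt (1 - 4 / x ^ 2) = Real.sqrt (x ^ 2 - 4) / x := by
      rw [show (1 : ℝ) - 4 / x ^ 2 = (x ^ 2 - 4) / x ^ 2 by field_simp,
        Real.sqrt_div hpos.le, Real.sqrt_sq (by linarith)]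
    rw [hsx]
    have e1 : Real.exp (-2) * (-stdNormalPdf (Real.sqrt (x ^ 2 - 4)) *
        (x / Real.sqrt (x ^ 2 - 4))) = -stdNormalPdf x * (x / Real.sqrt (x ^ 2 - 4)) := by
      rw [← hp]; ring
    rw [e1]
    have e2 : x ^ 2 * ((1 / 2) * (1 + Real.sqrt (x ^ 2 - 4) / x)) ^ 2
        = (x + Real.sqrt (x ^ 2 - 4)) ^ 2 / 4 := by
      have : x ≠ 0 := by linarith
      field_simp
      ring
    rw [e2]
    simp only [Pi.add_apply, id]
    linear_combination (-(1 / 2) * stdNormalPdf x) * husq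
  · intro x hx
    have := stdNormalPdf_nonneg x
    positivity
  · have := (gaussQ_tendsto.sub boundary_tendsto).sub
      ((gaussQ_tendsto.comp sqrt_tendsto_aux).const_mul (Real.exp (-2)))
    simpa using this
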